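/- Let L be a mixed 1-stack 1-queue layout of G(k,ℓ) with k > 4 and ℓ > 6, let {u,v} be a queue-edge of G(k-3,ℓ) with u ≺ v, and let x1,…,x7 be queue-attachments of {u,v} in Ḡ(k-2,ℓ) with u ≺ x1 ≺ … ≺ x7 ≺ v. Then for 3 ≤ i ≤ 5 there is no vertex w of Ḡ(k-1,ℓ) attached to {v,x_i} that is a mixed-attachment with stack-edge {w,x_i} and satisfies u ≺ w ≺ x1, and there is no vertex w of Ḡ(k-1,ℓ) attached to {u,x_i} that is a mixed-attachment with stack-edge {w,x_i} and satisfies x7 ≺ w ≺ v. -/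

import Mathlib

/-- Vertices for the graphs `G(k,ℓ)`: two base vertices and, for each step `k`,
each oriented edge `(u,v)` and each index `i : Fin ℓ`, a potential attached vertex. -/
inductive PV (ℓ : ℕ) : Type where
  | A : PV ℓ
  | B : PV ℓ
  | att : ℕ → PV ℓ → PV ℓ → Fin ℓ → PV ℓ

/-- The (canonically oriented) edges of `G(k,ℓ)`: `G(1,ℓ)` is the single edge `(A,B)`,
and for `k > 1`, `G(k,ℓ)` is obtained from `G(k-1,ℓ)` by attaching `ℓ` new vertices
to each of its edges. -/
def Gedges (ℓ : ℕ) : ℕ → Set (PV ℓ × PV ℓ)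
  | 0 => ∅
  | 1 => {p | p = (PV.A, PV.B)}
  | (k + 2) => Gedges ℓ (k + 1) ∪
      {p | ∃ u v, ∃ i : Fin ℓ, (u, v) ∈ Gedges ℓ (k + 1) ∧
        (p = (PV.att (k + 2) u v i, u) ∨ p = (PV.att (k + 2) u v i, v))}

/-- The graph `G(k,ℓ)`. -/
def Gkl (k ℓ : ℕ) : SimpleGraph (PV ℓ) :=
  SimpleGraph.fromEdgeSet ((fun p => s(p.1, p.2)) '' Gedges ℓ k)

/-- The graph `Ḡ(k,ℓ)` induced by the edges of `G(k,ℓ)` that are not in `G(k-1,ℓ)`. -/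
def Gbar (k ℓ : ℕ) : SimpleGraph (PV ℓ) :=
  SimpleGraph.fromEdgeSet ((fun p => s(p.1, p.2)) '' (Gedges ℓ k \ Gedges ℓ (k - 1)))

/-- A mixed 1-stack 1-queue layout of a graph `G`: a strict total (linear) order `lt`
on the vertices together with an assignment of each edge to the stack (`isStack e`)
or to the queue (`¬ isStack e`), such that no two stack-edges cross and no two
queue-edges nest. -/
structure MixedLayout {V : Type} (G : SimpleGraph V) where
  lt : V → V → Prop
  isSTO : IsStrictTotalOrder V lt
  isStack : Sym2 V → Prop
  noCross : ∀ a b c d : V, G.Adj a b → G.Adj c d →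
    isStack s(a, b) → isStack s(c, d) → ¬(lt a c ∧ lt c b ∧ lt b d)
  noNest : ∀ a b c d : V, G.Adj a b → G.Adj c d →
    ¬isStack s(a, b) → ¬isStack s(c, d) → ¬(lt a c ∧ lt c d ∧ lt d b)

/-- `{a,b}` is an edge of the subgraph `H` that is a stack-edge in the layout `L`. -/
def SEdgeIn {V : Type} {G : SimpleGraph V} (L : MixedLayout G) (H : SimpleGraph V)
    (a b : V) : Prop :=
  H.Adj a b ∧ L.isStack s(a, b)

/-- `{a,b}` is an edge of the subgraph `H` that is a queue-edge in the layout `L`. -/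
def QEdgeIn {V : Type} {G : SimpleGraph V} (L : MixedLayout G) (H : SimpleGraph V)
    (a b : V) : Prop :=
  H.Adj a b ∧ ¬L.isStack s(a, b)

/-- `x` is a stack-attachment of the edge `{u,v}`: both `{x,u}` and `{x,v}` are
stack-edges. -/
def StackAtt {V : Type} {G : SimpleGraph V} (L : MixedLayout G) (x u v : V) : Prop :=
  SEdgeIn L G x u ∧ SEdgeIn L G x v

/-- `x` is a queue-attachment of the edge `{u,v}`: both `{x,u}` and `{x,v}` are
queue-edges. -/
def QueueAtt {V : Type} {G : SimpleGraph V} (L : MixedLayout G) (x u v : V) : Prop :=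
  QEdgeIn L G x u ∧ QEdgeIn L G x v

/-- `x` is a mixed-attachment of the edge `{u,v}`: one of `{x,u}`, `{x,v}` is a
stack-edge and the other is a queue-edge. -/
def MixedAtt {V : Type} {G : SimpleGraph V} (L : MixedLayout G) (x u v : V) : Prop :=
  (SEdgeIn L G x u ∧ QEdgeIn L G x v) ∨ (QEdgeIn L G x u ∧ SEdgeIn L G x v)

/-- `x` is one of the vertices of `Ḡ(k,ℓ)` attached to the edge `{u,v}`, i.e. both
`{x,u}` and `{x,v}` are edges of `Ḡ(k,ℓ)`. -/
def AttachedAt (ℓ k : ℕ) (x u v : PV ℓ) : Prop :=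
  (Gbar k ℓ).Adj x u ∧ (Gbar k ℓ).Adj x v

/-- A smiley face `⟨a,b,u,v,c,d⟩` formed by vertices and edges of the subgraph `H`
in the layout `L`: `a ≺ b ≺ u ≺ v ≺ c ≺ d`, the edges `{a,b}`, `{c,d}`, `{a,d}` of `H`
are queue-edges and the edge `{u,v}` of `H` is a stack-edge. -/
def Smiley {V : Type} {G : SimpleGraph V} (L : MixedLayout G) (H : SimpleGraph V)
    (a b u v c d : V) : Prop :=
  L.lt a b ∧ L.lt b u ∧ L.lt u v ∧ L.lt v c ∧ L.lt c d ∧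
  QEdgeIn L H a b ∧ QEdgeIn L H c d ∧ QEdgeIn L H a d ∧ SEdgeIn L H u v

/-- The step at which a vertex is introduced. -/
def PV.level {ℓ : ℕ} : PV ℓ → ℕ
  | .A => 0
  | .B => 0
  | .att n _ _ _ => n

lemma level_le_of_mem_Gedges {ℓ : ℕ} :
    ∀ {n : ℕ} {p : PV ℓ × PV ℓ}, p ∈ Gedges ℓ n → p.1.level ≤ n ∧ p.2.level ≤ n
  | 0, _, h => by simp [Gedges] at h
  | 1, _, h => by
    obtain rfl : _ = _ := h
    simp [PV.level]
  | n + 2, p, h => by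
    rcases h with h | ⟨a, b, i, hab, rfl | rfl⟩
    · have := level_le_of_mem_Gedges h
      omega
    all_goals
      have := level_le_of_mem_Gedges hab
      simp only [PV.level] at this ⊢
      omega

lemma level_le_of_Gkl_adj {ℓ n : ℕ} {a b : PV ℓ} (h : (Gkl n ℓ).Adj a b) :
    a.level ≤ n ∧ b.level ≤ n := by
  simp only [Gkl, SimpleGraph.fromEdgeSet_adj, Set.mem_image] at h
  obtain ⟨⟨p, hp, he⟩, -⟩ := h
  have := level_le_of_mem_Gedges hp
  rcases Sym2.eq_iff.1 he with ⟨rfl, rfl⟩ | ⟨rfl, rfl⟩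
  · exact this
  · exact this.symm

lemma Gbar_le_Gkl (n ℓ : ℕ) : Gbar n ℓ ≤ Gkl n ℓ :=
  SimpleGraph.fromEdgeSet_mono (Set.image_mono Set.sdiff_subset)

lemma Gkl_le_succ (n ℓ : ℕ) : Gkl n ℓ ≤ Gkl (n + 1) ℓ := by
  refine SimpleGraph.fromEdgeSet_mono (Set.image_mono ?_)
  cases n with
  | zero => simp [Gedges]
  | succ n => exact Set.subset_union_left

/-- Every edge of `G(n,ℓ)` has `ℓ` distinct vertices attached to it in `G(n+1,ℓ)`. -/
lemma exists_attached {ℓ n : ℕ} {a b : PV ℓ} (h : (Gkl n ℓ).Adj a b) :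
    ∃ f : Fin ℓ → PV ℓ, Function.Injective f ∧
      ∀ i, (f i).level = n + 1 ∧ (Gkl (n + 1) ℓ).Adj (f i) a ∧ (Gkl (n + 1) ℓ).Adj (f i) b := by
  have hlev := level_le_of_Gkl_adj h
  simp only [Gkl, SimpleGraph.fromEdgeSet_adj, Set.mem_image] at h
  obtain ⟨⟨⟨s, t⟩, hp, he⟩, -⟩ := h
  obtain ⟨m, rfl⟩ : ∃ m, n = m + 1 := by
    cases n with
    | zero => simp [Gedges] at hp
    | succ m => exact ⟨m, rfl⟩
  have key : ∀ (i : Fin ℓ) (c : PV ℓ), c = s ∨ c = t → c.level ≤ m + 1 →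
      (Gkl (m + 1 + 1) ℓ).Adj (PV.att (m + 2) s t i) c := by
    intro i c hc hl
    simp only [Gkl, SimpleGraph.fromEdgeSet_adj, Set.mem_image]
    refine ⟨⟨(PV.att (m + 2) s t i, c), Or.inr ⟨s, t, i, hp, ?_⟩, rfl⟩, ?_⟩
    · rcases hc with rfl | rfl <;> simp
    · rintro rfl
      simp [PV.level] at hl
  refine ⟨fun i => PV.att (m + 2) s t i, fun i j hij => by simpa using hij, fun i => ⟨rfl, ?_⟩⟩
  rcases Sym2.eq_iff.1 he with ⟨h1, h2⟩ | ⟨h1, h2⟩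
  · exact ⟨key i a (.inl h1.symm) hlev.1, key i b (.inr h2.symm) hlev.2⟩
  · exact ⟨key i a (.inr h2.symm) hlev.1, key i b (.inl h1.symm) hlev.2⟩

/-- A graph with a `K_{2,3}` subgraph has no one-page book embedding. -/
lemma false_of_noncrossing_K23 {V : Type} [LinearOrder V] {S : V → V → Prop}
    (symm : ∀ a b, S a b → S b a)
    (noCross : ∀ a b c d, S a b → S c d → ¬(a < c ∧ c < b ∧ b < d))
    {p z : V} (hpz : p ≠ z) (y : Fin 3 → V) (hy : Function.Injective y)
    (hp : ∀ i, S (y i) p) (hz : ∀ i, S (y i) z)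
    (hyp : ∀ i, y i ≠ p) (hyz : ∀ i, y i ≠ z) : False := by
  wlog hlt : p < z generalizing p z
  · exact this hpz.symm hz hp hyz hyp (lt_of_le_of_ne (not_lt.1 hlt) hpz.symm)
  have side : ∀ i j, y i < y j → ¬(p < y i ∧ y i < z ↔ p < y j ∧ y j < z) := by
    intro i j hij hiff
    have h1 := noCross _ _ _ _ (symm _ _ (hp j)) (hz i)
    have h2 := noCross _ _ _ _ (hp i) (hz j)
    have h3 := noCross _ _ _ _ (symm _ _ (hp i)) (symm _ _ (hz j))
    have h4 := noCross _ _ _ _ (hz i) (symm _ _ (hp j))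
    have := hyp i
    have := hyp j
    have := hyz i
    have := hyz j
    grind
  have side' : ∀ i j, i ≠ j → ¬(p < y i ∧ y i < z ↔ p < y j ∧ y j < z) := by
    intro i j hij
    rcases lt_or_gt_of_ne (hy.ne hij) with h | h
    · exact side i j h
    · exact fun hiff => side j i h hiff.symm
  have h01 := side' 0 1 (by decide)
  have h02 := side' 0 2 (by decide)
  have h12 := side' 1 2 (by decide)
  tauto

/-- Let `{u,v}`, `{u,q}`, `{r,v}` be queue-edges with `u ≺ q ≺ p ≺ r ≺ v`, where `p` is adjacent
to `u` in `G(k+1,ℓ)`. Then no stack-edge `{a,b}` satisfies `u ≺ a ≺ p ≺ b ≺ v`. -/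
lemma not_covered_by_stack_edge {k ℓ : ℕ} (hl : 2 < ℓ) (L : MixedLayout (Gkl (k + 3) ℓ))
    {u v p q r a b : PV ℓ} (hu : u.level ≤ k + 1) (hv : v.level ≤ k + 1)
    (hpu : (Gkl (k + 1) ℓ).Adj p u)
    (huv : QEdgeIn L (Gkl (k + 3) ℓ) u v) (hq : QEdgeIn L (Gkl (k + 3) ℓ) u q)
    (hr : QEdgeIn L (Gkl (k + 3) ℓ) r v) (hab : SEdgeIn L (Gkl (k + 3) ℓ) a b)
    (huq : L.lt u q) (hqp : L.lt q p) (hpr : L.lt p r) (hrv : L.lt r v)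
    (hua : L.lt u a) (hap : L.lt a p) (hpb : L.lt p b) (hbv : L.lt b v) : False := by
  classical
  have := L.isSTO
  let : LinearOrder (PV ℓ) := linearOrderOfSTO L.lt
  change u < q at huq
  change q < p at hqp
  change p < r at hpr
  change r < v at hrv
  change u < a at hua
  change a < p at hap
  change p < b at hpb
  change b < v at hbv
  have noNest : ∀ a b c d : PV ℓ, QEdgeIn L (Gkl (k + 3) ℓ) a b → QEdgeIn L (Gkl (k + 3) ℓ) c d →
      ¬(a < c ∧ c < d ∧ d < b) := fun a b c d h h' => L.noNest a b c d h.1 h'.1 h.2 h'.2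
  have noCross : ∀ a b c d : PV ℓ, SEdgeIn L (Gkl (k + 3) ℓ) a b → SEdgeIn L (Gkl (k + 3) ℓ) c d →
      ¬(a < c ∧ c < b ∧ b < d) := fun a b c d h h' => L.noCross a b c d h.1 h'.1 h.2 h'.2
  have qsymm : ∀ a b, QEdgeIn L (Gkl (k + 3) ℓ) a b → QEdgeIn L (Gkl (k + 3) ℓ) b a :=
    fun a b h => ⟨h.1.symm, by rw [Sym2.eq_swap]; exact h.2⟩
  have ssymm : ∀ a b, SEdgeIn L (Gkl (k + 3) ℓ) a b → SEdgeIn L (Gkl (k + 3) ℓ) b a :=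
    fun a b h => ⟨h.1.symm, by rw [Sym2.eq_swap]; exact h.2⟩
  have stack_or_queue : ∀ a b, (Gkl (k + 3) ℓ).Adj a b →
      SEdgeIn L (Gkl (k + 3) ℓ) a b ∨ QEdgeIn L (Gkl (k + 3) ℓ) a b := fun a b h => by
    by_cases hs : L.isStack s(a, b)
    · exact .inl ⟨h, hs⟩
    · exact .inr ⟨h, hs⟩
  have inside : ∀ y, (Gkl (k + 3) ℓ).Adj y p → y ≠ u → y ≠ v → u < y ∧ y < v := by
    intro y hy hyu hyv
    by_contra hout
    have hcase : y < u ∨ v < y := by grind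
    rcases stack_or_queue y p hy with h | h
    · have h1 := noCross _ _ _ _ h hab
      have h2 := noCross _ _ _ _ hab (ssymm _ _ h)
      grind
    · have h1 := noNest _ _ _ _ h hq
      have h2 := noNest _ _ _ _ (qsymm _ _ h) hr
      grind
  have stack_of_inside : ∀ y z, (Gkl (k + 3) ℓ).Adj y z → u < y ∧ y < v → u < z ∧ z < v →
      SEdgeIn L (Gkl (k + 3) ℓ) y z := by
    intro y z h hy hz
    refine (stack_or_queue y z h).resolve_right fun hQ => ?_
    have h1 := noNest _ _ _ _ huv hQ
    have h2 := noNest _ _ _ _ huv (qsymm _ _ hQ)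
    have := h.ne
    grind
  have hup : u < p ∧ p < v := ⟨huq.trans hqp, hpr.trans hrv⟩
  have ne_of_level : ∀ {s t : PV ℓ}, s.level ≠ t.level → s ≠ t := fun h e => h (e ▸ rfl)
  obtain ⟨f, -, hf⟩ := exists_attached hpu
  obtain ⟨hzl, hzp, -⟩ := hf ⟨0, by omega⟩
  generalize f ⟨0, by omega⟩ = z at hzl hzp
  have hz := inside z (Gkl_le_succ _ _ hzp) (ne_of_level (by omega)) (ne_of_level (by omega))
  obtain ⟨g, hg, hgy⟩ := exists_attached hzp
  have hy : ∀ i, u < g i ∧ g i < v := fun i =>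
    inside (g i) (hgy i).2.2 (ne_of_level (by have := (hgy i).1; omega))
      (ne_of_level (by have := (hgy i).1; omega))
  exact false_of_noncrossing_K23 ssymm noCross hzp.ne.symm (g ∘ Fin.castLE hl)
    (hg.comp (Fin.castLE_injective hl))
    (fun i => stack_of_inside _ _ (hgy _).2.2 (hy _) hup)
    (fun i => stack_of_inside _ _ (hgy _).2.1 (hy _) hz)
    (fun i => (hgy _).2.2.ne) (fun i => (hgy _).2.1.ne)

/-- Claim 4: in the setting of Lemma 4, for `3 ≤ i ≤ 5` (here `2 ≤ j ≤ 4`) there is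
no mixed-attachment `w` of `{v, x j}` with stack-edge `{w, x j}` and `u ≺ w ≺ x 0`,
and no mixed-attachment `w` of `{u, x j}` with stack-edge `{w, x j}` and
`x 6 ≺ w ≺ v`. -/
theorem claim_between_u_x1 (k ℓ : ℕ) (hk : 4 < k) (hl : 6 < ℓ)
    (L : MixedLayout (Gkl k ℓ)) (u v : PV ℓ)
    (huv : QEdgeIn L (Gkl (k - 3) ℓ) u v) (huvlt : L.lt u v)
    (x : Fin 7 → PV ℓ)
    (hatt : ∀ j, AttachedAt ℓ (k - 2) (x j) u v ∧ QueueAtt L (x j) u v)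
    (hx0 : L.lt u (x 0)) (hx6 : L.lt (x 6) v)
    (hmono : ∀ j j' : Fin 7, j < j' → L.lt (x j) (x j')) :
    ∀ j : Fin 7, 2 ≤ (j : ℕ) → (j : ℕ) ≤ 4 →
      (¬∃ w : PV ℓ, AttachedAt ℓ (k - 1) w v (x j) ∧
        QEdgeIn L (Gkl k ℓ) w v ∧ SEdgeIn L (Gkl k ℓ) w (x j) ∧
        L.lt u w ∧ L.lt w (x 0)) ∧
      (¬∃ w : PV ℓ, AttachedAt ℓ (k - 1) w u (x j) ∧
        QEdgeIn L (Gkl k ℓ) w u ∧ SEdgeIn L (Gkl k ℓ) w (x j) ∧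
        L.lt (x 6) w ∧ L.lt w v) := by
  obtain ⟨k, rfl⟩ : ∃ m, k = m + 3 := ⟨k - 3, by omega⟩
  simp only [show k + 3 - 2 = k + 1 by omega, show k + 3 - 3 = k by omega] at hatt huv
  have hlev := level_le_of_Gkl_adj huv.1
  have huv' : QEdgeIn L (Gkl (k + 3) ℓ) u v :=
    ⟨Gkl_le_succ _ _ (Gkl_le_succ _ _ (Gkl_le_succ _ _ huv.1)), huv.2⟩
  have hq : QEdgeIn L (Gkl (k + 3) ℓ) u (x 0) :=
    ⟨(hatt 0).2.1.1.symm, by rw [Sym2.eq_swap]; exact (hatt 0).2.1.2⟩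
  have := L.isSTO
  have trans : ∀ {a b c}, L.lt a b → L.lt b c → L.lt a c := fun h h' => _root_.trans h h'
  have main : ∀ i : Fin 7, 0 < i → i < 6 → ∀ a b, SEdgeIn L (Gkl (k + 3) ℓ) a b →
      L.lt u a → L.lt a (x i) → L.lt (x i) b → L.lt b v → False :=
    fun i h0 h6 a b hab hua hai hib hbv =>
      not_covered_by_stack_edge (by omega) L (by omega) (by omega)
        (Gbar_le_Gkl _ _ (hatt i).1.1) huv' hq (hatt 6).2.2 hab hx0 (hmono _ _ h0) (hmono _ _ h6)
        hx6 hua hai hib hbv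
  intro j hj2 hj4
  have h1j : (1 : Fin 7) < j := by rw [Fin.lt_def]; exact hj2
  have hj5 : j < (5 : Fin 7) := by rw [Fin.lt_def]; exact Nat.lt_succ_of_le hj4
  have h56 : L.lt (x 5) (x 6) := hmono _ _ (by decide)
  have h01 : L.lt (x 0) (x 1) := hmono _ _ (by decide)
  constructor
  · rintro ⟨w, -, -, hs, huw, hw⟩
    exact main 1 (by decide) (by decide) w (x j) hs huw (trans hw h01) (hmono _ _ h1j)
      (trans (hmono _ _ hj5) (trans h56 hx6))
  · rintro ⟨w, -, -, hs, hw, hwv⟩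
    exact main 5 (by decide) (by decide) (x j) w
      ⟨hs.1.symm, by rw [Sym2.eq_swap]; exact hs.2⟩
      (trans hx0 (trans h01 (hmono _ _ h1j))) (hmono _ _ hj5) (trans h56 hw) hwv
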